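/- There exists a constant C > 0 (depending on b̃, β, a, α₁,…,α_m, ν, μ₁,…,μ_m, but not on x) such that A₂(x) ≤ C·(1 + V₂(x)) for all x ∈ D. -/

import Mathlib

open MeasureTheory ENNReal
open scoped RealInnerProductSpace

/-- `V₂(x) = log(1 + ‖x‖²)` on `ℝ^d` (Euclidean norm). -/
noncomputable def V2 (d : ℕ) (x : EuclideanSpace ℝ (Fin d)) : ℝ :=
  Real.log (1 + ‖x‖ ^ 2)

/-- `∇V₂(x) = 2x/(1 + ‖x‖²)`. -/
noncomputable def gradV2 (d : ℕ) (x : EuclideanSpace ℝ (Fin d)) :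
    EuclideanSpace ℝ (Fin d) :=
  (2 / (1 + ‖x‖ ^ 2)) • x

/-- `∂²V₂/∂x_k∂x_l(x) = 2δ_{kl}/(1 + ‖x‖²) − 4x_k x_l/(1 + ‖x‖²)²`. -/
noncomputable def hessV2 (d : ℕ) (x : EuclideanSpace ℝ (Fin d)) (k l : Fin d) : ℝ :=
  (if k = l then (2:ℝ) else 0) / (1 + ‖x‖ ^ 2) - 4 * x k * x l / (1 + ‖x‖ ^ 2) ^ 2

lemma aux_small {d : ℕ} (x ξ : EuclideanSpace ℝ (Fin d)) :
    V2 d (x + ξ) - V2 d x - ⟪ξ, gradV2 d x⟫ ≤ ‖ξ‖ ^ 2 / (1 + ‖x‖ ^ 2) := by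
  have hp : 0 < 1 + ‖x‖ ^ 2 := by positivity
  have hq : 0 < 1 + ‖x + ξ‖ ^ 2 := by positivity
  unfold V2 gradV2
  rw [← Real.log_div hq.ne' hp.ne', inner_smul_right, real_inner_comm]
  have h1 := Real.log_le_sub_one_of_pos (div_pos hq hp)
  have h2 : (1 + ‖x + ξ‖ ^ 2) / (1 + ‖x‖ ^ 2) - 1
      = 2 / (1 + ‖x‖ ^ 2) * ⟪x, ξ⟫ + ‖ξ‖ ^ 2 / (1 + ‖x‖ ^ 2) := by
    rw [norm_add_sq_real]; field_simp; ring
  linarith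

lemma aux_log {d : ℕ} (x ξ : EuclideanSpace ℝ (Fin d)) :
    V2 d (x + ξ) - V2 d x ≤ 2 * Real.log (1 + ‖ξ‖ / √(1 + ‖x‖ ^ 2)) := by
  have hp : 0 < 1 + ‖x‖ ^ 2 := by positivity
  have hq : 0 < 1 + ‖x + ξ‖ ^ 2 := by positivity
  have hs : 0 < √(1 + ‖x‖ ^ 2) := Real.sqrt_pos.2 hp
  have hs2 : √(1 + ‖x‖ ^ 2) ^ 2 = 1 + ‖x‖ ^ 2 := Real.sq_sqrt hp.le
  have hxs : ‖x‖ ≤ √(1 + ‖x‖ ^ 2) := Real.le_sqrt_of_sq_le (by linarith)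
  unfold V2
  rw [← Real.log_div hq.ne' hp.ne']
  have : 2 * Real.log (1 + ‖ξ‖ / √(1 + ‖x‖ ^ 2))
      = Real.log ((1 + ‖ξ‖ / √(1 + ‖x‖ ^ 2)) ^ 2) := by
    rw [Real.log_pow]; norm_num
  rw [this]
  apply Real.log_le_log (div_pos hq hp)
  have e : (1 + ‖ξ‖ / √(1 + ‖x‖ ^ 2)) ^ 2 = (√(1 + ‖x‖ ^ 2) + ‖ξ‖) ^ 2 / (1 + ‖x‖ ^ 2) := by
    rw [← hs2]
    simp only [Real.sqrt_sq hs.le]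
    field_simp
  rw [e]
  gcongr
  have h3 : ‖x + ξ‖ ^ 2 ≤ (‖x‖ + ‖ξ‖) ^ 2 := by gcongr; exact norm_add_le _ _
  nlinarith [mul_le_mul_of_nonneg_right hxs (norm_nonneg ξ)]

lemma aux_grad {d : ℕ} (x : EuclideanSpace ℝ (Fin d)) :
    ‖gradV2 d x‖ ≤ 2 / √(1 + ‖x‖ ^ 2) := by
  have hp : 0 < 1 + ‖x‖ ^ 2 := by positivity
  have hs : 0 < √(1 + ‖x‖ ^ 2) := Real.sqrt_pos.2 hp
  have hs2 : √(1 + ‖x‖ ^ 2) ^ 2 = 1 + ‖x‖ ^ 2 := Real.sq_sqrt hp.le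
  have hxs : ‖x‖ ≤ √(1 + ‖x‖ ^ 2) := Real.le_sqrt_of_sq_le (by linarith)
  unfold gradV2
  rw [norm_smul, Real.norm_of_nonneg (by positivity), div_mul_eq_mul_div,
    div_le_div_iff₀ hp hs]
  nlinarith

lemma aux_large {d : ℕ} (x ξ : EuclideanSpace ℝ (Fin d)) :
    V2 d (x + ξ) - V2 d x - ⟪ξ, gradV2 d x⟫ ≤ 4 * (‖ξ‖ / √(1 + ‖x‖ ^ 2)) := by
  have hp : 0 < 1 + ‖x‖ ^ 2 := by positivity
  have hs : 0 < √(1 + ‖x‖ ^ 2) := Real.sqrt_pos.2 hp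
  have h1 := aux_log x ξ
  have h0 : 0 ≤ ‖ξ‖ / √(1 + ‖x‖ ^ 2) := by positivity
  have h2 := Real.log_le_sub_one_of_pos (show 0 < 1 + ‖ξ‖ / √(1 + ‖x‖ ^ 2) by positivity)
  have h3 := neg_le_of_abs_le (abs_real_inner_le_norm ξ (gradV2 d x))
  have h4 : ‖ξ‖ * ‖gradV2 d x‖ ≤ ‖ξ‖ * (2 / √(1 + ‖x‖ ^ 2)) := by
    gcongr; exact aux_grad x
  have h5 : ‖ξ‖ * (2 / √(1 + ‖x‖ ^ 2)) = 2 * (‖ξ‖ / √(1 + ‖x‖ ^ 2)) := by ring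
  linarith

lemma aux_one_le {d : ℕ} (x : EuclideanSpace ℝ (Fin d)) : 1 ≤ √(1 + ‖x‖ ^ 2) :=
  Real.le_sqrt_of_sq_le (by nlinarith [sq_nonneg ‖x‖])

lemma aux_coord {d : ℕ} (x : EuclideanSpace ℝ (Fin d)) (k : Fin d) :
    |x k| ≤ √(1 + ‖x‖ ^ 2) := by
  have h1 : |x k| ≤ ‖x‖ := by simpa using PiLp.norm_apply_le x k
  exact h1.trans (Real.le_sqrt_of_sq_le (by linarith))

lemma aux_mu {d : ℕ} (x ξ : EuclideanSpace ℝ (Fin d)) (t : ℝ) (ht : 0 ≤ t)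
    (hts : t ≤ √(1 + ‖x‖ ^ 2)) :
    t * (V2 d (x + ξ) - V2 d x - ⟪ξ, gradV2 d x⟫) ≤ 4 * min ‖ξ‖ (‖ξ‖ ^ 2) := by
  have hp : 0 < 1 + ‖x‖ ^ 2 := by positivity
  have hs1 := aux_one_le x
  have hs : 0 < √(1 + ‖x‖ ^ 2) := Real.sqrt_pos.2 hp
  have hs2 : √(1 + ‖x‖ ^ 2) ^ 2 = 1 + ‖x‖ ^ 2 := Real.sq_sqrt hp.le
  rw [mul_min_of_nonneg _ _ (by norm_num : (0:ℝ) ≤ 4)]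
  apply le_min
  · calc _ ≤ t * (4 * (‖ξ‖ / √(1 + ‖x‖ ^ 2))) := by gcongr; exact aux_large x ξ
      _ ≤ √(1 + ‖x‖ ^ 2) * (4 * (‖ξ‖ / √(1 + ‖x‖ ^ 2))) := by gcongr
      _ = 4 * ‖ξ‖ := by field_simp
  · calc _ ≤ t * (‖ξ‖ ^ 2 / (1 + ‖x‖ ^ 2)) := by gcongr; exact aux_small x ξ
      _ ≤ (1 + ‖x‖ ^ 2) * (‖ξ‖ ^ 2 / (1 + ‖x‖ ^ 2)) := by gcongr; nlinarith
      _ = ‖ξ‖ ^ 2 := by field_simp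
      _ ≤ 4 * ‖ξ‖ ^ 2 := by nlinarith [sq_nonneg ‖ξ‖]

lemma aux_nu {d : ℕ} (x ξ : EuclideanSpace ℝ (Fin d)) :
    V2 d (x + ξ) - V2 d x - ⟪ξ, gradV2 d x⟫ * (if ‖ξ‖ ≤ 1 then (1:ℝ) else 0)
      ≤ 2 * min 1 (‖ξ‖ ^ 2) +
        2 * Set.indicator {ξ : EuclideanSpace ℝ (Fin d) | 1 < ‖ξ‖} (fun ξ => Real.log ‖ξ‖) ξ := by
  have hp : 0 < 1 + ‖x‖ ^ 2 := by positivity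
  have hs1 := aux_one_le x
  by_cases h : ‖ξ‖ ≤ 1
  · have hm : min 1 (‖ξ‖ ^ 2) = ‖ξ‖ ^ 2 := min_eq_right (by nlinarith [norm_nonneg ξ])
    rw [Set.indicator_of_notMem (by simpa using h), if_pos h, hm]
    have h1 := aux_small x ξ
    have h2 : ‖ξ‖ ^ 2 / (1 + ‖x‖ ^ 2) ≤ ‖ξ‖ ^ 2 :=
      div_le_self (by positivity) (by nlinarith [sq_nonneg ‖x‖])
    nlinarith [sq_nonneg ‖ξ‖]
  · have h' : 1 < ‖ξ‖ := not_le.1 h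
    have hm : min 1 (‖ξ‖ ^ 2) = 1 := min_eq_left (by nlinarith)
    rw [Set.indicator_of_mem (by simpa using h'), if_neg h, hm]
    have h1 := aux_log x ξ
    have h2 : Real.log (1 + ‖ξ‖ / √(1 + ‖x‖ ^ 2)) ≤ Real.log (2 * ‖ξ‖) := by
      apply Real.log_le_log (by positivity)
      have := div_le_self (norm_nonneg ξ) hs1
      linarith
    rw [Real.log_mul (by norm_num) (by linarith)] at h2
    have h3 := Real.log_two_lt_d9
    linarith

lemma aux_int {E : Type*} [MeasurableSpace E] {κ : Measure E} {f g : E → ℝ}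
    (hg : Integrable g κ) (h0 : ∀ x, 0 ≤ g x) (h : ∀ x, f x ≤ g x) :
    ∫ x, f x ∂κ ≤ ∫ x, g x ∂κ := by
  by_cases hf : Integrable f κ
  · exact integral_mono hf hg h
  · rw [integral_undef hf]; exact integral_nonneg h0

lemma aux_integrable {E : Type*} [MeasurableSpace E] {κ : Measure E} {f g : E → ℝ}
    (hf : Measurable f) (h0 : ∀ x, 0 ≤ f x) (h : ∀ᵐ x ∂κ, f x ≤ g x)
    (hg : ∫⁻ x, ENNReal.ofReal (g x) ∂κ ≠ ⊤) : Integrable f κ := by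
  refine ⟨hf.aestronglyMeasurable, ?_⟩
  rw [hasFiniteIntegral_iff_ofReal (Filter.Eventually.of_forall h0)]
  refine lt_of_le_of_lt (lintegral_mono_ae ?_) (lt_top_iff_ne_top.2 hg)
  filter_upwards [h] with x hx
  exact ENNReal.ofReal_le_ofReal hx

lemma aux_hess {d : ℕ} (x : EuclideanSpace ℝ (Fin d)) (k l : Fin d) :
    |hessV2 d x k l| ≤ 6 / (1 + ‖x‖ ^ 2) := by
  have hp : 0 < 1 + ‖x‖ ^ 2 := by positivity
  have hs2 : √(1 + ‖x‖ ^ 2) ^ 2 = 1 + ‖x‖ ^ 2 := Real.sq_sqrt hp.le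
  have hk := aux_coord x k
  have hl := aux_coord x l
  have hkl : |x k| * |x l| ≤ 1 + ‖x‖ ^ 2 := by
    rw [← hs2, sq]; gcongr
  unfold hessV2
  refine (abs_sub _ _).trans ?_
  have e : (6:ℝ) / (1 + ‖x‖ ^ 2) = 2 / (1 + ‖x‖ ^ 2) + 4 / (1 + ‖x‖ ^ 2) := by ring
  rw [e]
  apply add_le_add
  · rw [abs_div, abs_of_pos hp]
    gcongr
    split_ifs <;> norm_num
  · rw [abs_div, abs_of_pos (by positivity : 0 < (1 + ‖x‖ ^ 2) ^ 2), abs_mul, abs_mul,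
      div_le_div_iff₀ (by positivity) hp, abs_of_pos (by norm_num : (0:ℝ) < 4)]
    nlinarith

/-- There is a constant `C > 0` (depending on `b̃, β, a, α, ν, μ` but not on `x`) such that
`A₂(x) ≤ C·(1 + V₂(x))` for all `x` in the canonical state space `D = ℝ₊^m × ℝ^n`, where
`A₂(x) = ⟨b̃ + βx, ∇V₂(x)⟩ + Σ_{k,l} (a_{kl} + Σ_i α_{i,kl} x_i) ∂²V₂/∂x_k∂x_l(x)
 + ∫_D (V₂(x+ξ) − V₂(x) − ⟨ξ, ∇V₂(x)⟩·1_{‖ξ‖≤1}) ν(dξ)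
 + Σ_i x_i ∫_D (V₂(x+ξ) − V₂(x) − ⟨ξ, ∇V₂(x)⟩) μ_i(dξ)`,
`ν` and the `μ_i` are Borel measures supported on `D`, vanishing on `{0}`, with
`∫_D (1 ∧ ‖ξ‖² + Σ_i (1 ∧ ξ_i)) ν(dξ) < ∞`, `∫_{‖ξ‖>1} log(‖ξ‖) ν(dξ) < ∞` and
`∫_D (‖ξ‖ ∧ ‖ξ‖² + Σ_{k≠i} ξ_k) μ_i(dξ) < ∞`. -/
theorem A2_le_const_mul_one_add_V2 (m n : ℕ) (hd : 0 < m + n)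
    (btil : EuclideanSpace ℝ (Fin (m + n)))
    (β a : Matrix (Fin (m + n)) (Fin (m + n)) ℝ)
    (α : Fin m → Matrix (Fin (m + n)) (Fin (m + n)) ℝ)
    (ν : Measure (EuclideanSpace ℝ (Fin (m + n))))
    (μ : Fin m → Measure (EuclideanSpace ℝ (Fin (m + n))))
    (Dset : Set (EuclideanSpace ℝ (Fin (m + n))))
    (hDset : Dset = {x | ∀ i : Fin m, 0 ≤ x (Fin.castAdd n i)})
    (hν0 : ν {0} = 0) (hνD : ν Dsetᶜ = 0)
    (hν1 : ∫⁻ ξ, ENNReal.ofReal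
        (min 1 (‖ξ‖ ^ 2) + ∑ i : Fin m, min 1 (ξ (Fin.castAdd n i))) ∂ν ≠ ⊤)
    (hν2 : ∫⁻ ξ in {ξ | 1 < ‖ξ‖}, ENNReal.ofReal (Real.log ‖ξ‖) ∂ν ≠ ⊤)
    (hμ0 : ∀ i, μ i {0} = 0) (hμD : ∀ i, (μ i) Dsetᶜ = 0)
    (hμ1 : ∀ i, ∫⁻ ξ, ENNReal.ofReal
        (min ‖ξ‖ (‖ξ‖ ^ 2) +
          ∑ k ∈ Finset.univ.erase i, ξ (Fin.castAdd n k)) ∂(μ i) ≠ ⊤)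
    (A2 : EuclideanSpace ℝ (Fin (m + n)) → ℝ)
    (hA2 : ∀ x, A2 x =
      ⟪btil + Matrix.toEuclideanLin β x, gradV2 (m + n) x⟫ +
      (∑ k : Fin (m + n), ∑ l : Fin (m + n),
        (a k l + ∑ i : Fin m, α i k l * x (Fin.castAdd n i)) * hessV2 (m + n) x k l) +
      (∫ ξ, (V2 (m + n) (x + ξ) - V2 (m + n) x -
        ⟪ξ, gradV2 (m + n) x⟫ * (if ‖ξ‖ ≤ 1 then (1:ℝ) else 0)) ∂ν) +
      ∑ i : Fin m, x (Fin.castAdd n i) *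
        ∫ ξ, (V2 (m + n) (x + ξ) - V2 (m + n) x - ⟪ξ, gradV2 (m + n) x⟫) ∂(μ i)) :
    ∃ C > (0:ℝ), ∀ x ∈ Dset, A2 x ≤ C * (1 + V2 (m + n) x) := by
  classical
  set T := LinearMap.toContinuousLinearMap (Matrix.toEuclideanLin β) with hT
  have hνae : ∀ᵐ ξ ∂ν, ξ ∈ Dset := by rw [ae_iff]; exact hνD
  have hμae : ∀ i, ∀ᵐ ξ ∂(μ i), ξ ∈ Dset := fun i => by rw [ae_iff]; exact hμD i
  -- integrability of the dominating functions
  have hI1 : Integrable (fun ξ : EuclideanSpace ℝ (Fin (m + n)) => min 1 (‖ξ‖ ^ 2)) ν := by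
    refine aux_integrable (by fun_prop) (fun ξ => by positivity) ?_ hν1
    filter_upwards [hνae] with ξ hξ
    rw [hDset] at hξ
    have : 0 ≤ ∑ i : Fin m, min 1 (ξ (Fin.castAdd n i)) :=
      Finset.sum_nonneg fun i _ => le_min zero_le_one (hξ i)
    linarith
  have hms : MeasurableSet {ξ : EuclideanSpace ℝ (Fin (m + n)) | 1 < ‖ξ‖} :=
    measurableSet_lt measurable_const measurable_norm
  have hI2 : Integrable (Set.indicator {ξ : EuclideanSpace ℝ (Fin (m + n)) | 1 < ‖ξ‖}
      (fun ξ => Real.log ‖ξ‖)) ν := by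
    rw [integrable_indicator_iff hms]
    refine ⟨(Real.measurable_log.comp measurable_norm).aestronglyMeasurable, ?_⟩
    rw [hasFiniteIntegral_iff_ofReal]
    · exact lt_top_iff_ne_top.2 hν2
    · filter_upwards [ae_restrict_mem hms] with ξ hξ
      exact Real.log_nonneg (le_of_lt hξ)
  have hI3 : ∀ i, Integrable
      (fun ξ : EuclideanSpace ℝ (Fin (m + n)) => min ‖ξ‖ (‖ξ‖ ^ 2)) (μ i) := by
    intro i
    refine aux_integrable (by fun_prop) (fun ξ => by positivity) ?_ (hμ1 i)
    filter_upwards [hμae i] with ξ hξ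
    rw [hDset] at hξ
    have : 0 ≤ ∑ k ∈ Finset.univ.erase i, ξ (Fin.castAdd n k) :=
      Finset.sum_nonneg fun k _ => hξ k
    linarith
  set c1 : ℝ := (‖btil‖ + ‖T‖) * 2
  set c2 : ℝ := ∑ k : Fin (m + n), ∑ l : Fin (m + n), (|a k l| + ∑ i : Fin m, |α i k l|) * 6
  set c3 : ℝ := ∫ ξ, (2 * min 1 (‖ξ‖ ^ 2) +
        2 * Set.indicator {ξ : EuclideanSpace ℝ (Fin (m + n)) | 1 < ‖ξ‖}
          (fun ξ => Real.log ‖ξ‖) ξ) ∂ν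
  set c4 : ℝ := ∑ i : Fin m, ∫ ξ, 4 * min ‖ξ‖ (‖ξ‖ ^ 2) ∂(μ i)
  have hg0 : ∀ ξ : EuclideanSpace ℝ (Fin (m + n)), 0 ≤ 2 * min 1 (‖ξ‖ ^ 2) +
        2 * Set.indicator {ξ : EuclideanSpace ℝ (Fin (m + n)) | 1 < ‖ξ‖}
          (fun ξ => Real.log ‖ξ‖) ξ := by
    intro ξ
    have : 0 ≤ Set.indicator {ξ : EuclideanSpace ℝ (Fin (m + n)) | 1 < ‖ξ‖}
          (fun ξ => Real.log ‖ξ‖) ξ :=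
      Set.indicator_nonneg (fun ξ hξ => Real.log_nonneg (le_of_lt hξ)) ξ
    positivity
  have hc1 : 0 ≤ c1 := by positivity
  have hc2 : 0 ≤ c2 := by positivity
  have hc3 : 0 ≤ c3 := integral_nonneg hg0
  have hc4 : 0 ≤ c4 := Finset.sum_nonneg fun i _ => integral_nonneg fun ξ => by positivity
  refine ⟨c1 + c2 + c3 + c4 + 1, by positivity, fun x hx => ?_⟩
  rw [hDset] at hx
  have hp : 0 < 1 + ‖x‖ ^ 2 := by positivity
  have hs1 := aux_one_le x
  have hs : 0 < √(1 + ‖x‖ ^ 2) := Real.sqrt_pos.2 hp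
  have hs2 : √(1 + ‖x‖ ^ 2) ^ 2 = 1 + ‖x‖ ^ 2 := Real.sq_sqrt hp.le
  have hxs : ‖x‖ ≤ √(1 + ‖x‖ ^ 2) := Real.le_sqrt_of_sq_le (by linarith)
  have hV : 0 ≤ V2 (m + n) x := Real.log_nonneg (by nlinarith [sq_nonneg ‖x‖])
  have h1 : ⟪btil + Matrix.toEuclideanLin β x, gradV2 (m + n) x⟫ ≤ c1 := by
    have hTx : ‖Matrix.toEuclideanLin β x‖ ≤ ‖T‖ * ‖x‖ := T.le_opNorm x
    have hn : ‖btil + Matrix.toEuclideanLin β x‖ ≤ (‖btil‖ + ‖T‖) * √(1 + ‖x‖ ^ 2) := by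
      refine (norm_add_le _ _).trans ?_
      nlinarith [mul_le_mul_of_nonneg_left hxs (norm_nonneg T),
        mul_le_mul_of_nonneg_left hs1 (norm_nonneg btil)]
    calc _ ≤ ‖btil + Matrix.toEuclideanLin β x‖ * ‖gradV2 (m + n) x‖ := real_inner_le_norm _ _
      _ ≤ ((‖btil‖ + ‖T‖) * √(1 + ‖x‖ ^ 2)) * (2 / √(1 + ‖x‖ ^ 2)) := by
          gcongr; exact aux_grad x
      _ = c1 := by simp only [c1]; field_simp
  have h2 : (∑ k : Fin (m + n), ∑ l : Fin (m + n),
        (a k l + ∑ i : Fin m, α i k l * x (Fin.castAdd n i)) * hessV2 (m + n) x k l) ≤ c2 := by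
    refine Finset.sum_le_sum fun k _ => Finset.sum_le_sum fun l _ => ?_
    have hA : |a k l + ∑ i : Fin m, α i k l * x (Fin.castAdd n i)|
        ≤ (|a k l| + ∑ i : Fin m, |α i k l|) * (1 + ‖x‖ ^ 2) := by
      refine (abs_add_le _ _).trans ?_
      rw [add_mul, Finset.sum_mul]
      apply add_le_add
      · nlinarith [mul_nonneg (abs_nonneg (a k l)) (sq_nonneg ‖x‖)]
      · refine (Finset.abs_sum_le_sum_abs _ _).trans (Finset.sum_le_sum fun i _ => ?_)
        rw [abs_mul]
        gcongr
        have := aux_coord x (Fin.castAdd n i)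
        nlinarith
    calc _ ≤ |a k l + ∑ i : Fin m, α i k l * x (Fin.castAdd n i)| * |hessV2 (m + n) x k l| := by
          rw [← abs_mul]; exact le_abs_self _
      _ ≤ ((|a k l| + ∑ i : Fin m, |α i k l|) * (1 + ‖x‖ ^ 2)) * (6 / (1 + ‖x‖ ^ 2)) := by
          gcongr; exact aux_hess x k l
      _ = _ := by field_simp
  have h3 : (∫ ξ, (V2 (m + n) (x + ξ) - V2 (m + n) x -
        ⟪ξ, gradV2 (m + n) x⟫ * (if ‖ξ‖ ≤ 1 then (1:ℝ) else 0)) ∂ν) ≤ c3 :=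
    aux_int ((hI1.const_mul 2).add (hI2.const_mul 2)) hg0 (fun ξ => aux_nu x ξ)
  have h4 : ∑ i : Fin m, x (Fin.castAdd n i) *
        ∫ ξ, (V2 (m + n) (x + ξ) - V2 (m + n) x - ⟪ξ, gradV2 (m + n) x⟫) ∂(μ i) ≤ c4 := by
    refine Finset.sum_le_sum fun i _ => ?_
    rw [← integral_const_mul]
    exact aux_int ((hI3 i).const_mul 4) (fun ξ => by positivity)
      (fun ξ => aux_mu x ξ _ (hx i) ((le_abs_self _).trans (aux_coord x _)))
  rw [hA2 x]
  have : 0 ≤ (c1 + c2 + c3 + c4 + 1) * V2 (m + n) x := by positivity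
  linarith
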